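/- Let (X,d_X) and (Y,d_Y) be metric spaces and h : X → Y a bijection such that (1/L)·d_X(x,x') ≤ d_Y(h(x),h(x')) ≤ L·d_X(x,x') for all x, x' ∈ X and some L ≥ 1. Let A ⊆ X. If there exists an extension operator for Lipschitz pseudometrics from A to X with norm at most M, then there exists an extension operator for Lipschitz pseudometrics from h(A) to Y with norm at most L²·M. In particular, Λ(X) = sup{Λ(A,X) : A ⊆ X} is a bi-Lipschitz invariant in the sense that finiteness of Λ is preserved under bi-Lipschitz homeomorphisms. -/

import Mathlib

open Set

section Defs

variable {X : Type*}

/-- `ρ` is a pseudometric on the subset `A`: nonnegative, symmetric,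
vanishing on the diagonal, and satisfying the triangle inequality on `A`. -/
def IsPseudometricOn (A : Set X) (ρ : X → X → ℝ) : Prop :=
  (∀ x ∈ A, ∀ y ∈ A, 0 ≤ ρ x y) ∧
  (∀ x ∈ A, ∀ y ∈ A, ρ x y = ρ y x) ∧
  (∀ x ∈ A, ρ x x = 0) ∧
  (∀ x ∈ A, ∀ y ∈ A, ∀ z ∈ A, ρ x z ≤ ρ x y + ρ y z)

/-- `ρ x y ≤ M * d x y` on `A`; for a Lipschitz pseudometric this says `‖ρ‖_A ≤ M`. -/
def PMNormLE (d : X → X → ℝ) (A : Set X) (ρ : X → X → ℝ) (M : ℝ) : Prop :=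
  ∀ x ∈ A, ∀ y ∈ A, ρ x y ≤ M * d x y

/-- `ρ` is a Lipschitz pseudometric on `A` with respect to the distance `d`. -/
def IsLipPM (d : X → X → ℝ) (A : Set X) (ρ : X → X → ℝ) : Prop :=
  IsPseudometricOn A ρ ∧ ∃ C > 0, PMNormLE d A ρ C

/-- `ρ` is a Lipschitz metric on `A` with respect to the distance `d`. -/
def IsLipM (d : X → X → ℝ) (A : Set X) (ρ : X → X → ℝ) : Prop :=
  IsLipPM d A ρ ∧ ∀ x ∈ A, ∀ y ∈ A, x ≠ y → 0 < ρ x y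

/-- `u` is an extension operator for Lipschitz pseudometrics from `A` to `B`:
it maps Lipschitz pseudometrics on `A` to Lipschitz pseudometrics on `B`,
is additive and positively homogeneous, and `u ρ` restricts to `ρ` on `A × A`. -/
def IsPMExtOp (d : X → X → ℝ) (A B : Set X) (u : (X → X → ℝ) → X → X → ℝ) : Prop :=
  (∀ ρ, IsLipPM d A ρ → IsLipPM d B (u ρ)) ∧
  (∀ ρ₁ ρ₂, IsLipPM d A ρ₁ → IsLipPM d A ρ₂ →
    u (fun x y => ρ₁ x y + ρ₂ x y) = fun x y => u ρ₁ x y + u ρ₂ x y) ∧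
  (∀ c : ℝ, 0 ≤ c → ∀ ρ, IsLipPM d A ρ →
    u (fun x y => c * ρ x y) = fun x y => c * u ρ x y) ∧
  (∀ ρ, IsLipPM d A ρ → ∀ x ∈ A, ∀ y ∈ A, u ρ x y = ρ x y)

/-- `‖u‖ ≤ M` for an operator on Lipschitz pseudometrics:
`‖ρ‖_A ≤ 1` implies `‖u ρ‖_B ≤ M`. -/
def PMOpNormLE (d : X → X → ℝ) (A B : Set X) (u : (X → X → ℝ) → X → X → ℝ) (M : ℝ) : Prop :=
  ∀ ρ, IsLipPM d A ρ → PMNormLE d A ρ 1 → PMNormLE d B (u ρ) M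

/-- `u` is an extension operator for Lipschitz metrics from `A` to `B`. -/
def IsMExtOp (d : X → X → ℝ) (A B : Set X) (u : (X → X → ℝ) → X → X → ℝ) : Prop :=
  (∀ ρ, IsLipM d A ρ → IsLipM d B (u ρ)) ∧
  (∀ ρ₁ ρ₂, IsLipM d A ρ₁ → IsLipM d A ρ₂ →
    u (fun x y => ρ₁ x y + ρ₂ x y) = fun x y => u ρ₁ x y + u ρ₂ x y) ∧
  (∀ c : ℝ, 0 < c → ∀ ρ, IsLipM d A ρ →
    u (fun x y => c * ρ x y) = fun x y => c * u ρ x y) ∧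
  (∀ ρ, IsLipM d A ρ → ∀ x ∈ A, ∀ y ∈ A, u ρ x y = ρ x y)

/-- `‖u‖ ≤ M` for an operator on Lipschitz metrics. -/
def MOpNormLE (d : X → X → ℝ) (A B : Set X) (u : (X → X → ℝ) → X → X → ℝ) (M : ℝ) : Prop :=
  ∀ ρ, IsLipM d A ρ → PMNormLE d A ρ 1 → PMNormLE d B (u ρ) M

/-- `|f x - f y| ≤ M * d x y` on `A`; i.e. the Lipschitz seminorm `‖f‖_A ≤ M`. -/
def FunNormLE (d : X → X → ℝ) (A : Set X) (f : X → ℝ) (M : ℝ) : Prop :=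
  ∀ x ∈ A, ∀ y ∈ A, |f x - f y| ≤ M * d x y

/-- `f` is Lipschitz on `A` with respect to the distance `d`. -/
def IsLipFun (d : X → X → ℝ) (A : Set X) (f : X → ℝ) : Prop :=
  ∃ C > 0, FunNormLE d A f C

/-- `v` is a linear extension operator for Lipschitz functions from `A` to `B`. -/
def IsFunExtOp (d : X → X → ℝ) (A B : Set X) (v : (X → ℝ) → X → ℝ) : Prop :=
  (∀ f, IsLipFun d A f → IsLipFun d B (v f)) ∧
  (∀ f g, IsLipFun d A f → IsLipFun d A g →
    v (fun x => f x + g x) = fun x => v f x + v g x) ∧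
  (∀ c : ℝ, ∀ f, IsLipFun d A f → v (fun x => c * f x) = fun x => c * v f x) ∧
  (∀ f, IsLipFun d A f → ∀ x ∈ A, v f x = f x)

/-- `‖v‖ ≤ M` for an operator on Lipschitz functions. -/
def FunOpNormLE (d : X → X → ℝ) (A B : Set X) (v : (X → ℝ) → X → ℝ) (M : ℝ) : Prop :=
  ∀ f, IsLipFun d A f → FunNormLE d A f 1 → FunNormLE d B (v f) M

/-- `λ(A, B)`: the infimum of the norms of linear extension operators for Lipschitz
functions from `A` to `B` (`⊤` if there is none). -/
noncomputable def lambdaFun (d : X → X → ℝ) (A B : Set X) : ENNReal :=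
  sInf {L : ENNReal | ∃ M : ℝ, L = ENNReal.ofReal M ∧
    ∃ v, IsFunExtOp d A B v ∧ FunOpNormLE d A B v M}

end Defs

theorem IsPseudometricOn.comp {X Y : Type*} {A : Set X} {B : Set Y} {f : X → Y}
    (hf : MapsTo f A B) {ρ : Y → Y → ℝ} (hρ : IsPseudometricOn B ρ) :
    IsPseudometricOn A (fun x y => ρ (f x) (f y)) :=
  ⟨fun _ hx _ hy => hρ.1 _ (hf hx) _ (hf hy), fun _ hx _ hy => hρ.2.1 _ (hf hx) _ (hf hy),
    fun _ hx => hρ.2.2.1 _ (hf hx),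
    fun _ hx _ hy _ hz => hρ.2.2.2 _ (hf hx) _ (hf hy) _ (hf hz)⟩

theorem PMNormLE.comp {X Y : Type*} {d : X → X → ℝ} {d' : Y → Y → ℝ} {A : Set X} {B : Set Y}
    {f : X → Y} (hf : MapsTo f A B) {K C : ℝ} (hC : 0 ≤ C)
    (hK : ∀ x x', d' (f x) (f x') ≤ K * d x x') {ρ : Y → Y → ℝ} (hρ : PMNormLE d' B ρ C) :
    PMNormLE d A (fun x y => ρ (f x) (f y)) (C * K) := by
  intro x hx y hy
  calc ρ (f x) (f y) ≤ C * d' (f x) (f y) := hρ _ (hf hx) _ (hf hy)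
    _ ≤ C * (K * d x y) := mul_le_mul_of_nonneg_left (hK x y) hC
    _ = C * K * d x y := (mul_assoc _ _ _).symm

theorem IsLipPM.comp {X Y : Type*} {d : X → X → ℝ} {d' : Y → Y → ℝ} {A : Set X} {B : Set Y}
    {f : X → Y} (hf : MapsTo f A B) {K : ℝ} (hK0 : 0 < K)
    (hK : ∀ x x', d' (f x) (f x') ≤ K * d x x') {ρ : Y → Y → ℝ} (hρ : IsLipPM d' B ρ) :
    IsLipPM d A (fun x y => ρ (f x) (f y)) := by
  obtain ⟨hp, C, hC, hn⟩ := hρ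
  exact ⟨hp.comp hf, C * K, mul_pos hC hK0, hn.comp hf hC.le hK⟩

theorem IsLipPM.const_mul {X : Type*} {d : X → X → ℝ} {A : Set X} {ρ : X → X → ℝ}
    (hρ : IsLipPM d A ρ) {c : ℝ} (hc : 0 < c) : IsLipPM d A (fun x y => c * ρ x y) := by
  obtain ⟨⟨h0, hs, hd, ht⟩, C, hC, hn⟩ := hρ
  refine ⟨⟨fun x hx y hy => mul_nonneg hc.le (h0 x hx y hy),
    fun x hx y hy => congrArg (c * ·) (hs x hx y hy), fun x hx => mul_eq_zero_of_right c (hd x hx),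
    fun x hx y hy z hz => ?_⟩, c * C, mul_pos hc hC, fun x hx y hy => ?_⟩
  · rw [← mul_add]
    exact mul_le_mul_of_nonneg_left (ht x hx y hy z hz) hc.le
  · rw [mul_assoc]
    exact mul_le_mul_of_nonneg_left (hn x hx y hy) hc.le

/-- An extension operator of norm at most `M` satisfies `‖u ρ‖ ≤ c * M` whenever `‖ρ‖ ≤ c`. -/
theorem PMOpNormLE.normLE_mul {X : Type*} {d : X → X → ℝ} {A B : Set X}
    {u : (X → X → ℝ) → X → X → ℝ} {M : ℝ} (hu : IsPMExtOp d A B u) (hM : PMOpNormLE d A B u M)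
    {ρ : X → X → ℝ} (hρ : IsLipPM d A ρ) {c : ℝ} (hc : 0 < c) (hρc : PMNormLE d A ρ c) :
    PMNormLE d B (u ρ) (c * M) := by
  intro x hx y hy
  have h := hM _ (hρ.const_mul (inv_pos.2 hc)) (fun a ha b hb => by
    rw [one_mul, inv_mul_le_iff₀ hc]
    exact hρc a ha b hb) x hx y hy
  rw [hu.2.2.1 _ (inv_pos.2 hc).le ρ hρ, inv_mul_le_iff₀ hc] at h
  rwa [mul_assoc]

theorem exists_pmExtOp_image {X Y : Type*} [MetricSpace X] [MetricSpace Y]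
    (e : X ≃ Y) {L : ℝ} (hL : 0 < L)
    (hlow : ∀ y y' : Y, dist (e.symm y) (e.symm y') ≤ L * dist y y')
    (hup : ∀ x x' : X, dist (e x) (e x') ≤ L * dist x x') {A : Set X} {M : ℝ}
    {u : (X → X → ℝ) → X → X → ℝ} (hu : IsPMExtOp dist A univ u)
    (hM : PMOpNormLE dist A univ u M) :
    ∃ u', IsPMExtOp (dist : Y → Y → ℝ) (e '' A) univ u' ∧
      PMOpNormLE (dist : Y → Y → ℝ) (e '' A) univ u' (L ^ 2 * M) := by
  have hpull : ∀ ρ, IsLipPM dist (e '' A) ρ → IsLipPM dist A (fun x y => ρ (e x) (e y)) :=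
    fun ρ hρ => hρ.comp (mapsTo_image e A) hL hup
  refine ⟨fun ρ y y' => u (fun a b => ρ (e a) (e b)) (e.symm y) (e.symm y'),
    ⟨fun ρ hρ => (hu.1 _ (hpull ρ hρ)).comp (mapsTo_univ _ _) hL hlow, ?_, ?_, ?_⟩, ?_⟩
  · intro ρ₁ ρ₂ h₁ h₂
    funext y y'
    exact congrFun₂ (hu.2.1 _ _ (hpull _ h₁) (hpull _ h₂)) _ _
  · intro c hc ρ hρ
    funext y y'
    exact congrFun₂ (hu.2.2.1 c hc _ (hpull _ hρ)) _ _
  · rintro ρ hρ _ ⟨a, ha, rfl⟩ _ ⟨b, hb, rfl⟩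
    simpa using hu.2.2.2 _ (hpull _ hρ) a ha b hb
  · intro ρ hρ hρ1 y _ y' _
    have hn : PMNormLE dist A (fun x y => ρ (e x) (e y)) L := by
      simpa using hρ1.comp (mapsTo_image e A) zero_le_one hup
    have h := hM.normLE_mul hu (hpull _ hρ) hL hn
      (e.symm y) (mem_univ _) (e.symm y') (mem_univ _)
    rcases eq_or_ne y y' with rfl | hne
    · simpa using h
    have h0 := (hu.1 _ (hpull _ hρ)).1.1 (e.symm y) (mem_univ _) (e.symm y') (mem_univ _)
    have hd : 0 < dist (e.symm y) (e.symm y') := dist_pos.2 (e.symm.injective.ne hne)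
    have hLM : 0 ≤ L * M := nonneg_of_mul_nonneg_left (h0.trans h) hd
    calc _ ≤ L * M * dist (e.symm y) (e.symm y') := h
      _ ≤ L * M * (L * dist y y') := mul_le_mul_of_nonneg_left (hlow y y') hLM
      _ = L ^ 2 * M * dist y y' := by ring

/-- An `L`-bi-Lipschitz bijection `e : X → Y` transfers an extension operator for
Lipschitz pseudometrics from `A ⊆ X` (norm `≤ M`) to one from `e(A) ⊆ Y` (norm `≤ L²M`);
in particular finiteness of `Λ(X) = sup_A Λ(A,X)` is a bi-Lipschitz invariant. -/
theorem pm_ext_op_biLipschitz_transfer {X Y : Type*} [MetricSpace X] [MetricSpace Y]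
    (e : X → Y) (he : Function.Bijective e) (L : ℝ) (hL : 1 ≤ L)
    (hlow : ∀ x x' : X, (1 / L) * dist x x' ≤ dist (e x) (e x'))
    (hup : ∀ x x' : X, dist (e x) (e x') ≤ L * dist x x')
    (A : Set X) (M : ℝ) :
    ((∃ u, IsPMExtOp (dist : X → X → ℝ) A univ u ∧
        PMOpNormLE (dist : X → X → ℝ) A univ u M) →
      ∃ u', IsPMExtOp (dist : Y → Y → ℝ) (e '' A) univ u' ∧
        PMOpNormLE (dist : Y → Y → ℝ) (e '' A) univ u' (L ^ 2 * M)) ∧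
    ((∃ M₀ : ℝ, ∀ A' : Set X, ∃ u, IsPMExtOp (dist : X → X → ℝ) A' univ u ∧
        PMOpNormLE (dist : X → X → ℝ) A' univ u M₀) →
      ∃ M₁ : ℝ, ∀ B : Set Y, ∃ u, IsPMExtOp (dist : Y → Y → ℝ) B univ u ∧
        PMOpNormLE (dist : Y → Y → ℝ) B univ u M₁) := by
  have hL0 : 0 < L := one_pos.trans_le hL
  let f := Equiv.ofBijective e he
  have hlow' : ∀ y y' : Y, dist (f.symm y) (f.symm y') ≤ L * dist y y' := by
    intro y y'
    have h := hlow (f.symm y) (f.symm y')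
    rw [one_div, inv_mul_le_iff₀ hL0] at h
    change _ ≤ L * dist (f (f.symm y)) (f (f.symm y')) at h
    simpa using h
  refine ⟨fun ⟨u, hu, hM⟩ => exists_pmExtOp_image f hL0 hlow' hup hu hM, ?_⟩
  rintro ⟨M₀, h⟩
  refine ⟨L ^ 2 * M₀, fun B => ?_⟩
  obtain ⟨u, hu, hM⟩ := h (f ⁻¹' B)
  have := exists_pmExtOp_image f hL0 hlow' hup hu hM
  rwa [image_preimage_eq B f.surjective] at this
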